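/- arXiv:2207.12942 — 2 statements merged into one kernel-verified Lean document; each statement's English description precedes it below -/
import Mathlib

section
/- For every d ≥ 2, the two extended Gray curves are isometric: applying the signed permutation ω_d that negates the d-th axis (ω_d(x) = −x if |x| = d, ω_d(x) = x otherwise, applied entrywise) to the inverse of G″(d) yields G′(d); that is, ω_d(−R(⟨d−1, G(d), d⟩)) = ⟨d, G(d), −(d−1)⟩. -/
/-- `grayInv S = −R(S)`, the reversal of `S` with every entry negated (the inverse of `S`). -/
def grayInv (S : List ℤ) : List ℤ := S.reverse.map (fun x => -x)

/-- The Gray sequence approximants: `G 0 = ⟨⟩` and `G d = ⟨G (d−1), d, −R(G (d−1))⟩`. -/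
def gray : ℕ → List ℤ
  | 0 => []
  | d + 1 => gray d ++ [((d : ℤ) + 1)] ++ grayInv (gray d)

theorem grayInv_append (S T : List ℤ) : grayInv (S ++ T) = grayInv T ++ grayInv S := by
  simp [grayInv]

theorem grayInv_cons (a : ℤ) (S : List ℤ) : grayInv (a :: S) = grayInv S ++ [-a] := by
  simp [grayInv]

theorem grayInv_grayInv (S : List ℤ) : grayInv (grayInv S) = S := by
  simp [grayInv, List.map_reverse]

theorem mem_grayInv {x : ℤ} {S : List ℤ} : x ∈ grayInv S ↔ -x ∈ S := by
  simp [grayInv, neg_eq_iff_eq_neg]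

theorem natAbs_le_of_mem_gray {d : ℕ} {x : ℤ} (hx : x ∈ gray d) : x.natAbs ≤ d := by
  induction d generalizing x with
  | zero => simp [gray] at hx
  | succ d ih =>
    simp only [gray, List.mem_append, List.mem_singleton, mem_grayInv] at hx
    rcases hx with (hx | hx) | hx
    · exact (ih hx).trans d.le_succ
    · omega
    · have := ih hx
      omega

/-- Negating an axis that does not occur in a list leaves the list unchanged. -/
theorem map_negAxis_eq_self {n : ℕ} {S : List ℤ} (hS : ∀ x ∈ S, x.natAbs < n) :
    S.map (fun x => if x.natAbs = n then -x else x) = S :=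
  (List.map_congr_left fun x hx => if_neg (hS x hx).ne).trans (List.map_id' S)

/-- Negating the top axis in the inverse of `gray (d + 1)` recovers `gray (d + 1)`. -/
theorem map_negAxis_grayInv_gray_succ (d : ℕ) :
    (grayInv (gray (d + 1))).map (fun x => if x.natAbs = d + 1 then -x else x)
      = gray (d + 1) := by
  have h₁ : ∀ x ∈ gray d, x.natAbs < d + 1 := fun x hx =>
    Nat.lt_succ_of_le (natAbs_le_of_mem_gray hx)
  have h₂ : ∀ x ∈ grayInv (gray d), x.natAbs < d + 1 := fun x hx => by
    simpa using h₁ (-x) (mem_grayInv.1 hx)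
  have h₃ : (-((d : ℤ) + 1)).natAbs = d + 1 := by omega
  simp only [gray, grayInv_append, grayInv_grayInv, List.map_append, map_negAxis_eq_self h₁,
    map_negAxis_eq_self h₂]
  simp only [grayInv, List.reverse_singleton, List.map_cons, List.map_nil, h₃, if_true, neg_neg,
    List.append_assoc]

/-- For every `d ≥ 2`, applying the signed permutation negating the `d`-th axis to the
inverse of `G″(d) = ⟨d−1, G(d), d⟩` yields `G′(d) = ⟨d, G(d), −(d−1)⟩`. -/
theorem grayExt_isometric (d : ℕ) (hd : 2 ≤ d) :
    (grayInv (((d : ℤ) - 1) :: (gray d ++ [(d : ℤ)]))).map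
        (fun x => if x.natAbs = d then -x else x)
      = (d : ℤ) :: (gray d ++ [-((d : ℤ) - 1)]) := by
  obtain ⟨n, rfl⟩ : ∃ n, d = n + 1 := ⟨d - 1, by omega⟩
  have h₁ : (-((n + 1 : ℕ) : ℤ)).natAbs = n + 1 := by omega
  have h₂ : (-(((n + 1 : ℕ) : ℤ) - 1)).natAbs ≠ n + 1 := by omega
  rw [grayInv_cons, grayInv_append, List.map_append, List.map_append,
    map_negAxis_grayInv_gray_succ]
  simp only [grayInv, List.reverse_singleton, List.map_cons, List.map_nil, if_pos h₁, if_neg h₂,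
    neg_neg, List.nil_append, List.cons_append]
end

section
/- For every d ≥ 1 and every index n with 1 ≤ n ≤ 2^d − 1, the absolute value of the n-th entry of the Gray approximant G(d) equals the ruler function: |g_n| = ν₂(n) + 1, where ν₂(n) is the 2-adic valuation of n (the exponent of the largest power of 2 dividing n). -/
theorem length_gray (d : ℕ) : (gray d).length + 1 = 2 ^ d := by
  induction d with
  | zero => simp [gray]
  | succ d ih => simp [gray, grayInv, pow_succ]; omega

theorem natAbs_getD_grayInv (S : List ℤ) {i : ℕ} (hi : i < S.length) :
    ((grayInv S).getD i 0).natAbs = (S.getD (S.length - 1 - i) 0).natAbs := by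
  have hi' : S.length - 1 - i < S.length := by omega
  simp [grayInv, List.getD_eq_getElem?_getD, hi, hi']

theorem padicValNat_le_of_add_eq_prime_pow {p : ℕ} [Fact p.Prime] {k m n : ℕ} (hm : m ≠ 0)
    (hn : n ≠ 0) (h : m + n = p ^ k) : padicValNat p m ≤ padicValNat p n := by
  have hdvd : p ^ padicValNat p m ∣ m := pow_padicValNat_dvd
  have hp : 1 < p := (Fact.out : p.Prime).one_lt
  have hlt : p ^ padicValNat p m < p ^ k :=
    (Nat.le_of_dvd (Nat.pos_of_ne_zero hm) hdvd).trans_lt (by omega)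
  have hk : padicValNat p m < k := (Nat.pow_lt_pow_iff_right hp).1 hlt
  refine (padicValNat_dvd_iff_le hn).1 ((Nat.dvd_add_right hdvd).1 ?_)
  exact h ▸ pow_dvd_pow p hk.le

theorem padicValNat_eq_of_add_eq_prime_pow {p : ℕ} [Fact p.Prime] {k m n : ℕ} (hm : m ≠ 0)
    (hn : n ≠ 0) (h : m + n = p ^ k) : padicValNat p m = padicValNat p n :=
  (padicValNat_le_of_add_eq_prime_pow hm hn h).antisymm
    (padicValNat_le_of_add_eq_prime_pow hn hm ((add_comm n m).trans h))

theorem natAbs_getD_gray (d i : ℕ) (hi : i < (gray d).length) :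
    ((gray d).getD i 0).natAbs = padicValNat 2 (i + 1) + 1 := by
  induction d generalizing i with
  | zero => simp [gray] at hi
  | succ d ih =>
    have hlen := length_gray d
    have hlen' := length_gray (d + 1)
    rw [pow_succ] at hlen'
    rw [gray, List.append_assoc]
    rcases lt_trichotomy i (gray d).length with h | h | h
    · rw [List.getD_append _ _ _ _ h, ih i h]
    · rw [List.getD_append_right _ _ _ _ h.ge, h, hlen, padicValNat.prime_pow]
      simp
      omega
    · obtain ⟨j, rfl⟩ := Nat.exists_eq_add_of_lt h
      have hj : j < (gray d).length := by omega
      rw [List.getD_append_right _ _ _ _ h.le,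
        show (gray d).length + j + 1 - (gray d).length = j + 1 by omega,
        List.singleton_append, List.getD_cons_succ, natAbs_getD_grayInv _ hj,
        ih _ (by omega)]
      congr 1
      exact padicValNat_eq_of_add_eq_prime_pow (k := d + 1) (by omega) (by omega)
        (by rw [pow_succ]; omega)

/-- For every `d ≥ 1` and every `1 ≤ n ≤ 2^d − 1`, the absolute value of the `n`-th entry
(1-indexed) of the Gray approximant `G(d)` equals the ruler function `ν₂(n) + 1`. -/
theorem gray_abs_eq_ruler (d n : ℕ) (hd : 1 ≤ d) (hn : 1 ≤ n) (hn' : n ≤ 2 ^ d - 1) :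
    ((gray d).getD (n - 1) 0).natAbs = padicValNat 2 n + 1 := by
  have hlen := length_gray d
  rw [natAbs_getD_gray d (n - 1) (by omega), Nat.sub_add_cancel hn]
end
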